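/- arXiv:2504.18656 — 2 statements merged into one kernel-verified Lean document; each statement's English description precedes it below -/
import Mathlib

section
/- Let F be a field and let a, b, c, M, N, K be nonnegative integers with aK < M, bK < N, and (a+c)K ≥ M. Assume either that F has characteristic 0, or that F has characteristic p for a prime p with M + (c−a)K ≤ p (as integers). Let I = (x^M, y^N, (x^a y^b (x+y)^c)^K) ⊆ F[x,y]. Then, with respect to the lexicographic monomial order with x > y, the ideal LT(I) generated by the leading monomials of all nonzero elements of I equals the monomial ideal (x^M, y^N) + ( x^{M−t−1} y^{(a+b+c)K−M+2t+1} : 0 ≤ t ≤ M−aK−1 ). -/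
open MvPolynomial

/-- `LeadPair g i j` says that `x^i y^j` is the leading monomial of `g` with respect to the
lexicographic monomial order with `x > y` on `F[x,y]`. -/
def LeadPair {F : Type*} [Field F] (g : MvPolynomial (Fin 2) F) (i j : ℕ) : Prop :=
  MvPolynomial.coeff (Finsupp.single 0 i + Finsupp.single 1 j) g ≠ 0 ∧
  ∀ i' j' : ℕ, MvPolynomial.coeff (Finsupp.single 0 i' + Finsupp.single 1 j') g ≠ 0 →
    i' < i ∨ (i' = i ∧ j' ≤ j)

/-- The set of leading monomials of nonzero elements of an ideal `I` of `F[x,y]`. -/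
def ltMon {F : Type*} [Field F] (I : Ideal (MvPolynomial (Fin 2) F)) :
    Set (MvPolynomial (Fin 2) F) :=
  {q | ∃ g ∈ I, g ≠ 0 ∧ ∃ i j : ℕ, LeadPair g i j ∧ q = X 0 ^ i * X 1 ^ j}

namespace Polynomial

theorem wronskian_ne_zero_of_natDegree_lt {F : Type*} [Field F] {P R : Polynomial F}
    (hP : P ≠ 0) (hR : R ≠ 0) (hlt : P.natDegree < R.natDegree)
    (hcast : ((R.natDegree - P.natDegree : ℕ) : F) ≠ 0) : Polynomial.wronskian P R ≠ 0 := by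
  intro h
  have hdeg (Q : Polynomial F) : (X * derivative Q).natDegree ≤ Q.natDegree := by
    rw [natDegree_le_iff_coeff_eq_zero]
    rintro (_ | n) hn
    · simp
    · simp [coeff_X_mul, coeff_derivative, coeff_eq_zero_of_natDegree_lt hn]
  have hcoeff (Q : Polynomial F) (n : ℕ) : (X * derivative Q).coeff n = n * Q.coeff n := by
    rcases n with _ | n
    · simp
    · simp [coeff_X_mul, coeff_derivative, mul_comm]
  have hX : P * (X * derivative R) - (X * derivative P) * R = 0 := by
    rw [wronskian] at h
    linear_combination X * h
  have hc := congrArg (fun Q => Q.coeff (P.natDegree + R.natDegree)) hX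
  simp only [coeff_sub, coeff_zero] at hc
  rw [coeff_mul_add_eq_of_natDegree_le le_rfl (hdeg R), coeff_mul_add_eq_of_natDegree_le (hdeg P) le_rfl,
    hcoeff, hcoeff] at hc
  rw [Nat.cast_sub hlt.le] at hcast
  refine mul_ne_zero (mul_ne_zero (leadingCoeff_ne_zero.2 hP) (leadingCoeff_ne_zero.2 hR)) hcast ?_
  simp only [leadingCoeff]
  linear_combination hc

/-- A band of `t + 1` consecutive vanishing coefficients of `(1 + X) ^ c * h` forces `h = 0`. -/
theorem eq_zero_of_coeff_one_add_X_pow_mul_eq_zero {F : Type*} [Field F]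
    {m t c : ℕ} {h : Polynomial F} (ht : t ≤ m) (hc : m < c)
    (hF : ∀ n : ℕ, 0 < n → n ≤ c + t → (n : F) ≠ 0) (hd : h.natDegree ≤ t)
    (hz : ∀ k, m - t ≤ k → k ≤ m → ((1 + X) ^ c * h).coeff k = 0) : h = 0 := by
  by_contra h0
  have h1X : (1 + X : Polynomial F).Monic := by
    rw [add_comm]; simpa using monic_X_add_C (1 : F)
  have hdeg1 : (1 + X : Polynomial F).natDegree = 1 := by
    rw [add_comm]; simpa using natDegree_X_add_C (1 : F)
  set G := (1 + X) ^ c * h with hG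
  have hGdeg : G.natDegree = c + h.natDegree := by
    rw [hG, (h1X.pow c).natDegree_mul' h0, natDegree_pow, hdeg1, mul_one]
  set P := G %ₘ X ^ (m + 1) with hP
  set Q := G /ₘ X ^ (m + 1) with hQ
  have hdecomp : P + X ^ (m + 1) * Q = G := modByMonic_add_div G (X ^ (m + 1))
  set R := X ^ (m + 1) * Q with hR
  have hPcoeff : ∀ k, m - t ≤ k → P.coeff k = 0 := by
    intro k hk
    by_cases hkm : k ≤ m
    · have := congrArg (fun p => p.coeff k) hdecomp
      simpa [hR, coeff_X_pow_mul', show ¬ m + 1 ≤ k by omega, hz k hk hkm] using this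
    · apply coeff_eq_zero_of_degree_lt
      refine (degree_modByMonic_lt G (monic_X_pow (m + 1))).trans_le ?_
      rw [degree_X_pow]
      exact_mod_cast (by omega : m + 1 ≤ k)
  have hP0 : P ≠ 0 := by
    intro hP0
    have hdvd : X ^ (m + 1) ∣ (1 + X) ^ c * h := ⟨Q, by rw [← hG, ← hdecomp, hP0, zero_add]⟩
    have hcop : IsCoprime (X ^ (m + 1) : Polynomial F) ((1 + X) ^ c) :=
      IsCoprime.pow ⟨-1, 1, by ring⟩
    have := natDegree_le_of_dvd (hcop.dvd_of_dvd_mul_left hdvd) h0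
    rw [natDegree_X_pow] at this
    omega
  have hPdeg : P.natDegree < m - t := by
    by_contra hlt
    exact leadingCoeff_ne_zero.2 hP0 (hPcoeff _ (not_lt.1 hlt))
  have hR0 : R ≠ 0 := by
    intro hR0
    rw [hR0, add_zero] at hdecomp
    rw [hdecomp] at hPdeg
    omega
  have hRdeg : R.natDegree ≤ c + t := by
    have : R = G - P := by rw [← hdecomp]; ring
    rw [this]
    refine (natDegree_sub_le _ _).trans (max_le ?_ ?_) <;> omega
  have hRdeg' : m + 1 ≤ R.natDegree := by
    simpa using natDegree_le_of_dvd (Dvd.intro Q hR.symm) hR0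
  have hW : wronskian P R ≠ 0 :=
    wronskian_ne_zero_of_natDegree_lt hP0 hR0 (by omega) (hF _ (by omega) (by omega))
  have hXdvd : X ^ m ∣ wronskian P R := by
    refine ⟨P * (((m + 1 : ℕ) : Polynomial F) * Q + X * derivative Q) - derivative P * X * Q, ?_⟩
    simp only [wronskian, hR, derivative_mul, derivative_X_pow, Nat.add_sub_cancel, map_natCast]
    ring
  have h1dvd : (1 + X) ^ (c - 1) ∣ wronskian P R := by
    obtain ⟨e, rfl⟩ : ∃ e, c = e + 1 := ⟨c - 1, by omega⟩
    have : wronskian P R = wronskian P G := by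
      rw [← hdecomp]; simp only [wronskian, derivative_add]; ring
    rw [this]
    refine ⟨P * (((e + 1 : ℕ) : Polynomial F) * h + (1 + X) * derivative h)
      - derivative P * (1 + X) * h, ?_⟩
    simp only [wronskian, hG, derivative_mul, derivative_pow, derivative_add, derivative_one,
      derivative_X, Nat.add_sub_cancel, map_natCast]
    ring
  have hcop : IsCoprime (X ^ m : Polynomial F) ((1 + X) ^ (c - 1)) :=
    IsCoprime.pow ⟨-1, 1, by ring⟩
  have hle := natDegree_le_of_dvd (hcop.mul_dvd hXdvd h1dvd) hW
  rw [(monic_X_pow m).natDegree_mul (h1X.pow _), natDegree_X_pow, natDegree_pow, hdeg1] at hle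
  have := natDegree_wronskian_lt_add hW
  omega

/-- The lowest coefficient of a band of `(1 + X) ^ c * h` can be prescribed to be `1` and
the remaining ones to be `0`. -/
theorem exists_coeff_one_add_X_pow_mul {F : Type*} [Field F]
    {m t c : ℕ} (ht : t ≤ m) (hc : m < c)
    (hF : ∀ n : ℕ, 0 < n → n ≤ c + t → (n : F) ≠ 0) :
    ∃ h : Polynomial F, h.natDegree ≤ t ∧ ((1 + X) ^ c * h).coeff (m - t) = 1 ∧
      ∀ k, m - t < k → k ≤ m → ((1 + X) ^ c * h).coeff k = 0 := by
  let φ : degreeLT F (t + 1) →ₗ[F] (Fin (t + 1) → F) :=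
    LinearMap.pi fun i => (lcoeff F (m - t + i)) ∘ₗ
      (LinearMap.mulLeft F ((1 + X : Polynomial F) ^ c)) ∘ₗ (degreeLT F (t + 1)).subtype
  have hφ (h : degreeLT F (t + 1)) (i : Fin (t + 1)) :
      φ h i = ((1 + X) ^ c * (h : Polynomial F)).coeff (m - t + i) := rfl
  have hdeg (h : degreeLT F (t + 1)) : (h : Polynomial F).natDegree ≤ t := by
    exact natDegree_le_of_degree_le (Order.lt_succ_iff.1 (mem_degreeLT.1 h.2))
  have hinj : Function.Injective φ := by
    rw [← LinearMap.ker_eq_bot, LinearMap.ker_eq_bot']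
    intro h hh
    apply Subtype.ext
    refine eq_zero_of_coeff_one_add_X_pow_mul_eq_zero ht hc hF (hdeg h) fun k hk hkm => ?_
    have := congrFun hh ⟨k - (m - t), by omega⟩
    rw [hφ] at this
    simpa [show m - t + (k - (m - t)) = k by omega] using this
  let e := degreeLTEquiv F (t + 1)
  have hsurj : Function.Surjective φ := by
    have : Function.Surjective (φ ∘ₗ e.symm.toLinearMap) :=
      LinearMap.injective_iff_surjective.1 (hinj.comp e.symm.injective)
    exact Function.Surjective.of_comp this
  obtain ⟨h, hh⟩ := hsurj (Pi.single 0 1)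
  refine ⟨h, hdeg h, ?_, fun k hk hkm => ?_⟩
  · simpa [hφ] using congrFun hh 0
  · have := congrFun hh ⟨k - (m - t), by omega⟩
    rw [hφ, Pi.single_eq_of_ne (by simp [Fin.ext_iff]; omega)] at this
    simpa [show m - t + (k - (m - t)) = k by omega] using this

end Polynomial

/-- The map `x ↦ X T`, `y ↦ T` from `F[x,y]` to `F[X][T]`, whose coefficient at `T ^ d` is the
dehomogenization of the degree `d` component. -/
noncomputable def degreeSlices (F : Type*) [Field F] :
    MvPolynomial (Fin 2) F →+* Polynomial (Polynomial F) :=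
  eval₂Hom (Polynomial.C.comp Polynomial.C)
    ![Polynomial.C Polynomial.X * Polynomial.X, Polynomial.X]

section degreeSlices

variable {F : Type*} [Field F]

theorem degreeSlices_X_zero :
    degreeSlices F (X 0) = Polynomial.C Polynomial.X * Polynomial.X := by
  simp [degreeSlices]

theorem degreeSlices_X_one : degreeSlices F (X 1) = Polynomial.X := by
  simp [degreeSlices]

theorem degreeSlices_C (r : F) :
    degreeSlices F (C r) = Polynomial.C (Polynomial.C r) := by
  simp [degreeSlices]

theorem single_add_single_fin_two (s : Fin 2 →₀ ℕ) :
    Finsupp.single 0 (s 0) + Finsupp.single 1 (s 1) = s := by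
  ext k; fin_cases k <;> simp

theorem single_add_single_inj {i j i' j' : ℕ} :
    (Finsupp.single 0 i + Finsupp.single 1 j : Fin 2 →₀ ℕ) =
      Finsupp.single 0 i' + Finsupp.single 1 j' ↔ i = i' ∧ j = j' := by
  simp [Finsupp.ext_iff, Fin.forall_fin_two]

theorem X_pow_mul_X_pow_eq_monomial (i j : ℕ) :
    (X 0 ^ i * X 1 ^ j : MvPolynomial (Fin 2) F) =
      monomial (Finsupp.single 0 i + Finsupp.single 1 j) 1 := by
  simp [X_pow_eq_monomial, monomial_mul]

theorem degreeSlices_monomial (i j : ℕ) (r : F) :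
    degreeSlices F (monomial (Finsupp.single 0 i + Finsupp.single 1 j) r) =
      Polynomial.C (Polynomial.C r * Polynomial.X ^ i) * Polynomial.X ^ (i + j) := by
  rw [← mul_one r, ← C_mul_monomial, ← X_pow_mul_X_pow_eq_monomial]
  simp only [map_mul, map_pow, degreeSlices_C, degreeSlices_X_zero, degreeSlices_X_one, map_one]
  ring

theorem coeff_coeff_degreeSlices (g : MvPolynomial (Fin 2) F) (d i : ℕ) :
    ((degreeSlices F g).coeff d).coeff i =
      if i ≤ d then coeff (Finsupp.single 0 i + Finsupp.single 1 (d - i)) g else 0 := by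
  induction g using MvPolynomial.induction_on' with
  | monomial s r =>
    rw [← single_add_single_fin_two s, degreeSlices_monomial]
    simp only [Polynomial.coeff_C_mul, Polynomial.coeff_X_pow, coeff_monomial,
      single_add_single_inj]
    by_cases hd : d = s 0 + s 1
    · simp only [hd, if_true, mul_one, Polynomial.coeff_C_mul, Polynomial.coeff_X_pow]
      split_ifs <;> first | omega | simp
    · simp only [hd, if_false, mul_zero, Polynomial.coeff_zero]
      split_ifs <;> first | omega | rfl
  | add p q hp hq =>
    simp only [map_add, Polynomial.coeff_add, hp, hq]
    split_ifs <;> simp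

theorem coeff_eq_coeff_degreeSlices (g : MvPolynomial (Fin 2) F) (i j : ℕ) :
    coeff (Finsupp.single 0 i + Finsupp.single 1 j) g =
      ((degreeSlices F g).coeff (i + j)).coeff i := by
  rw [coeff_coeff_degreeSlices, if_pos (Nat.le_add_right i j), Nat.add_sub_cancel_left]

theorem natDegree_coeff_degreeSlices_le (g : MvPolynomial (Fin 2) F) (d : ℕ) :
    ((degreeSlices F g).coeff d).natDegree ≤ d := by
  rw [Polynomial.natDegree_le_iff_coeff_eq_zero]
  intro i hi
  rw [coeff_coeff_degreeSlices, if_neg (by omega)]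

theorem exists_degreeSlices_eq {h : Polynomial F} {t : ℕ} (ht : h.natDegree ≤ t) :
    ∃ H : MvPolynomial (Fin 2) F, degreeSlices F H = Polynomial.C h * Polynomial.X ^ t := by
  refine ⟨∑ k ∈ Finset.range (t + 1),
    monomial (Finsupp.single 0 k + Finsupp.single 1 (t - k)) (h.coeff k), ?_⟩
  conv_rhs => rw [h.as_sum_range_C_mul_X_pow' (Nat.lt_succ_of_le ht)]
  rw [map_sum, map_sum, Finset.sum_mul]
  refine Finset.sum_congr rfl fun k hk => ?_
  rw [degreeSlices_monomial, Nat.add_sub_cancel' (Nat.lt_succ_iff.1 (Finset.mem_range.1 hk))]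

theorem degreeSlices_generator (a b c K : ℕ) :
    degreeSlices F ((X 0 ^ a * X 1 ^ b * (X 0 + X 1) ^ c) ^ K) =
      Polynomial.C (Polynomial.X ^ (a * K) * (1 + Polynomial.X) ^ (c * K)) *
        Polynomial.X ^ ((a + b + c) * K) := by
  simp only [map_mul, map_pow, map_add, degreeSlices_X_zero, degreeSlices_X_one, map_one]
  rw [show (Polynomial.C Polynomial.X * Polynomial.X + Polynomial.X : Polynomial (Polynomial F)) =
    (1 + Polynomial.C Polynomial.X) * Polynomial.X by ring]
  rw [add_mul (a + b), add_mul a]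
  simp only [mul_pow, ← pow_mul, pow_add]
  ring

end degreeSlices

theorem leadPair_monomial {F : Type*} [Field F] (i j : ℕ) :
    LeadPair (X 0 ^ i * X 1 ^ j : MvPolynomial (Fin 2) F) i j := by
  rw [X_pow_mul_X_pow_eq_monomial]
  refine ⟨by simp, fun i' j' h => ?_⟩
  rw [coeff_monomial] at h
  obtain ⟨rfl, rfl⟩ := single_add_single_inj.1 (ite_ne_right_iff.1 h).1
  exact Or.inr ⟨rfl, le_rfl⟩

theorem monomial_mem_ltMon {F : Type*} [Field F] {I : Ideal (MvPolynomial (Fin 2) F)} {i j : ℕ}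
    (h : X 0 ^ i * X 1 ^ j ∈ I) : X 0 ^ i * X 1 ^ j ∈ ltMon I :=
  ⟨_, h, by simp [X_pow_mul_X_pow_eq_monomial], i, j, leadPair_monomial i j, rfl⟩

section generators

variable {F : Type*} [Field F] {a b c M N K : ℕ}

/-- Every leading monomial of the ideal lies in the staircase. -/
theorem exists_le_of_leadPair
    (hacK : M ≤ (a + c) * K) (hF : ∀ n : ℕ, 0 < n → n < M + c * K - a * K → (n : F) ≠ 0)
    {g : MvPolynomial (Fin 2) F} {i j : ℕ}
    (hg : g ∈ Ideal.span ({X 0 ^ M, X 1 ^ N, (X 0 ^ a * X 1 ^ b * (X 0 + X 1) ^ c) ^ K} :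
      Set (MvPolynomial (Fin 2) F)))
    (hl : LeadPair g i j) (hi : i < M) (hj : j < N) :
    ∃ t < M - a * K, M - t - 1 ≤ i ∧ (a + b + c) * K - M + 2 * t + 1 ≤ j := by
  obtain ⟨p, z, hz, rfl⟩ := Ideal.mem_span_insert.1 hg
  obtain ⟨q, r, rfl⟩ := Ideal.mem_span_pair.1 hz
  have hcoeff (i' j' : ℕ) (hi' : i' < M) (hj' : j' < N) :
      coeff (Finsupp.single 0 i' + Finsupp.single 1 j') (p * X 0 ^ M + (q * X 1 ^ N +
        r * (X 0 ^ a * X 1 ^ b * (X 0 + X 1) ^ c) ^ K)) =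
      (Polynomial.X ^ (a * K) * ((1 + Polynomial.X) ^ (c * K) *
        if (a + b + c) * K ≤ i' + j' then
          (degreeSlices F r).coeff (i' + j' - (a + b + c) * K) else 0)).coeff i' := by
    have hx : coeff (Finsupp.single 0 i' + Finsupp.single 1 j') (p * X 0 ^ M) = 0 := by
      rw [X_pow_eq_monomial, coeff_mul_monomial', if_neg]
      intro hle
      have := hle 0
      simp at this
      omega
    have hy : coeff (Finsupp.single 0 i' + Finsupp.single 1 j') (q * X 1 ^ N) = 0 := by
      rw [X_pow_eq_monomial, coeff_mul_monomial', if_neg]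
      intro hle
      have := hle 1
      simp at this
      omega
    rw [coeff_add, coeff_add, hx, hy, zero_add, zero_add, coeff_eq_coeff_degreeSlices, map_mul,
      degreeSlices_generator, ← mul_assoc, Polynomial.coeff_mul_X_pow', ← mul_assoc]
    split_ifs
    · rw [Polynomial.coeff_mul_C, mul_comm]
    · simp
  have hD : (a + b + c) * K = a * K + b * K + c * K := by ring
  have hac : (a + c) * K = a * K + c * K := by ring
  obtain ⟨hne, hmax⟩ := hl
  have hne' := hne
  rw [hcoeff i j hi hj, Polynomial.coeff_X_pow_mul'] at hne'
  obtain ⟨hai, hne'⟩ := ite_ne_right_iff.1 hne'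
  have hdeg : (a + b + c) * K ≤ i + j := by
    by_contra hlt
    simp [hlt] at hne'
  rw [if_pos hdeg] at hne'
  refine ⟨M - 1 - i, by omega, by omega, ?_⟩
  suffices M - 1 - i ≤ i + j - (a + b + c) * K by omega
  by_contra hlt
  have hzero := Polynomial.eq_zero_of_coeff_one_add_X_pow_mul_eq_zero
    (m := M - 1 - a * K) (t := i + j - (a + b + c) * K) (c := c * K)
    (h := (degreeSlices F r).coeff (i + j - (a + b + c) * K)) (by omega) (by omega)
    (fun n hn hn' => hF n hn (by omega)) (natDegree_coeff_degreeSlices_le r _) (fun k hk hkm => by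
      by_contra hnz
      have hk' := hcoeff (k + a * K) (i + j - (k + a * K)) (by omega) (by omega)
      rw [Nat.add_sub_cancel' (by omega), if_pos hdeg, add_comm k, Polynomial.coeff_X_pow_mul',
        if_pos (by omega), Nat.add_sub_cancel_left] at hk'
      rcases hmax _ _ (hk'.trans_ne hnz) with h | h <;> omega)
  simp [hzero] at hne'

/-- The corners of the staircase are leading monomials. -/
theorem corner_mem_ltMon
    (hacK : M ≤ (a + c) * K) (hF : ∀ n : ℕ, 0 < n → n < M + c * K - a * K → (n : F) ≠ 0)
    {t : ℕ} (ht : t < M - a * K) :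
    X 0 ^ (M - t - 1) * X 1 ^ ((a + b + c) * K - M + 2 * t + 1) ∈
      ltMon (Ideal.span ({X 0 ^ M, X 1 ^ N, (X 0 ^ a * X 1 ^ b * (X 0 + X 1) ^ c) ^ K} :
        Set (MvPolynomial (Fin 2) F))) := by
  have hD : (a + b + c) * K = a * K + b * K + c * K := by ring
  have hac : (a + c) * K = a * K + c * K := by ring
  obtain ⟨h, hdeg, hone, hzero⟩ := Polynomial.exists_coeff_one_add_X_pow_mul (F := F)
    (m := M - 1 - a * K) (t := t) (c := c * K) (by omega) (by omega)
    (fun n hn hn' => hF n hn (by omega))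
  obtain ⟨H, hH⟩ := exists_degreeSlices_eq hdeg
  set f : MvPolynomial (Fin 2) F := (X 0 ^ a * X 1 ^ b * (X 0 + X 1) ^ c) ^ K with hf
  have hfH (i j : ℕ) : coeff (Finsupp.single 0 i + Finsupp.single 1 j) (f * H) =
      if i + j = (a + b + c) * K + t ∧ a * K ≤ i then
        ((1 + Polynomial.X) ^ (c * K) * h).coeff (i - a * K) else 0 := by
    have : degreeSlices F (f * H) = Polynomial.C (Polynomial.X ^ (a * K) *
        ((1 + Polynomial.X) ^ (c * K) * h)) * Polynomial.X ^ ((a + b + c) * K + t) := by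
      rw [map_mul, hf, degreeSlices_generator, hH, ← mul_assoc (Polynomial.X ^ (a * K)),
        Polynomial.C_mul (b := h), pow_add]
      ring
    rw [coeff_eq_coeff_degreeSlices, this, Polynomial.coeff_C_mul, Polynomial.coeff_X_pow]
    by_cases hd : i + j = (a + b + c) * K + t
    · simp only [hd, if_true, mul_one, true_and, Polynomial.coeff_X_pow_mul']
    · simp [hd]
  set g := modMonomial (f * H) (Finsupp.single 0 M) with hg
  have hgcoeff (i j : ℕ) : coeff (Finsupp.single 0 i + Finsupp.single 1 j) g =
      if i < M then coeff (Finsupp.single 0 i + Finsupp.single 1 j) (f * H) else 0 := by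
    split_ifs with hi
    · refine coeff_modMonomial_of_not_le _ fun hle => ?_
      have := hle 0
      simp at this
      omega
    · refine coeff_modMonomial_of_le _ ?_
      rw [Finsupp.single_le_iff]
      simpa using hi
  have hlead : LeadPair g (M - t - 1) ((a + b + c) * K - M + 2 * t + 1) := by
    refine ⟨?_, fun i j hij => ?_⟩
    · rw [hgcoeff, if_pos (by omega), hfH, if_pos (by omega),
        show M - t - 1 - a * K = M - 1 - a * K - t by omega, hone]
      exact one_ne_zero
    · rw [hgcoeff, hfH] at hij
      obtain ⟨hi, hij⟩ := ite_ne_right_iff.1 hij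
      obtain ⟨⟨hd, hai⟩, hij⟩ := ite_ne_right_iff.1 hij
      have : i ≤ M - t - 1 := by
        by_contra hlt
        exact hij (hzero _ (by omega) (by omega))
      omega
  refine ⟨g, ?_, fun h0 => hlead.1 (by rw [h0, coeff_zero]), _, _, hlead, rfl⟩
  have hdiv := divMonomial_add_modMonomial (f * H) (Finsupp.single 0 M)
  rw [← hg, ← X_pow_eq_monomial] at hdiv
  rw [← sub_eq_of_eq_add' hdiv.symm]
  exact sub_mem (Ideal.mul_mem_right _ _ (Ideal.subset_span (by simp)))
    (Ideal.mul_mem_right _ _ (Ideal.subset_span (by simp)))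

end generators

/-- The initial ideal of `I = (x^M, y^N, (x^a y^b (x+y)^c)^K)` when
`aK < M`, `bK < N`, and `(a+c)K ≥ M`. -/
theorem stmt10 (F : Type*) [Field F] (a b c M N K : ℕ)
    (haK : a * K < M) (hbK : b * K < N) (hacK : M ≤ (a + c) * K)
    (hchar : CharP F 0 ∨
      ∃ p : ℕ, p.Prime ∧ CharP F p ∧ (M : ℤ) + ((c : ℤ) - (a : ℤ)) * K ≤ (p : ℤ)) :
    Ideal.span (ltMon (Ideal.span
        ({X 0 ^ M, X 1 ^ N, (X 0 ^ a * X 1 ^ b * (X 0 + X 1) ^ c) ^ K} :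
          Set (MvPolynomial (Fin 2) F))))
      = Ideal.span (({X 0 ^ M, X 1 ^ N} : Set (MvPolynomial (Fin 2) F)) ∪
          {q | ∃ t : ℕ, t < M - a * K ∧
            q = X 0 ^ (M - t - 1) * X 1 ^ ((a + b + c) * K - M + 2 * t + 1)}) := by
  have hF : ∀ n : ℕ, 0 < n → n < M + c * K - a * K → (n : F) ≠ 0 := by
    intro n hn hnlt h0
    rcases hchar with h | ⟨p, -, h, hp⟩
    · have := (CharP.cast_eq_zero_iff F 0 n).1 h0
      simp at this
      omega
    · have := Nat.le_of_dvd hn ((CharP.cast_eq_zero_iff F p n).1 h0)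
      have hp' : (M : ℤ) + (c * K : ℕ) - (a * K : ℕ) ≤ p := by push_cast; linarith
      omega
  apply le_antisymm
  · rw [Ideal.span_le]
    rintro _ ⟨g, hg, -, i, j, hl, rfl⟩
    rcases le_or_gt M i with hi | hi
    · exact Ideal.mul_mem_right _ _
        (Ideal.mem_of_dvd _ (pow_dvd_pow _ hi) (Ideal.subset_span (by simp)))
    rcases le_or_gt N j with hj | hj
    · exact Ideal.mul_mem_left _ _
        (Ideal.mem_of_dvd _ (pow_dvd_pow _ hj) (Ideal.subset_span (by simp)))
    obtain ⟨t, ht, hti, htj⟩ := exists_le_of_leadPair hacK hF hg hl hi hj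
    exact Ideal.mem_of_dvd _ (mul_dvd_mul (pow_dvd_pow _ hti) (pow_dvd_pow _ htj))
      (Ideal.subset_span (Or.inr ⟨t, ht, rfl⟩))
  · refine Ideal.span_mono ?_
    rintro _ ((rfl | rfl) | ⟨t, ht, rfl⟩)
    · simpa using monomial_mem_ltMon (F := F) (i := M) (j := 0)
        (by simpa using Ideal.subset_span (by simp))
    · simpa using monomial_mem_ltMon (F := F) (i := 0) (j := N)
        (by simpa using Ideal.subset_span (by simp))
    · exact corner_mem_ltMon hacK hF ht
end

section
/- Let p be a prime, let F be a field of characteristic p, and let k, m, n be positive integers with m ≤ p − k and n ≤ p − k. Let d₀ ≥ d₁ ≥ d₂ be the values k, m, n arranged in non-increasing order, and set t = k + m + n − 3. Let ℓ_{k,m,n} = dim_F F[x,y]/(x^m, y^n, (x+y)^k). Then: (a) if 2d₀ ≤ t + 1, then ℓ_{k,m,n} = C(⌊t/2⌋+2, 2) − ( C(⌊t/2⌋−k+2, 2) + C(⌊t/2⌋−m+2, 2) + C(⌊t/2⌋−n+2, 2) ); (b) if 2d₀ > t + 1, then ℓ_{k,m,n} = d₁·d₂. -/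
open MvPolynomial

/-- The ideal `(x^m, y^n, (x+y)^k)` of `F[x,y]`. -/
noncomputable def Ikmn (F : Type*) [Field F] (k m n : ℕ) : Ideal (MvPolynomial (Fin 2) F) :=
  Ideal.span ({X 0 ^ m, X 1 ^ n, (X 0 + X 1) ^ k} : Set (MvPolynomial (Fin 2) F))

namespace Polynomial

variable {F : Type*} [Field F]

theorem eq_C_of_derivative_eq_zero_of_degree_lt_char (p : ℕ) [CharP F p]
    {f : F[X]} (hf : derivative f = 0) (hdeg : f.degree < (p : ℕ)) : f = C (f.coeff 0) := by
  rw [degree_lt_iff_coeff_zero] at hdeg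
  ext i
  rcases i with _ | i
  · simp
  · rw [coeff_C_succ]
    by_cases hi : p ≤ i + 1
    · exact hdeg _ hi
    have h := congrArg (coeff · i) hf
    simp only [coeff_derivative, coeff_zero, mul_eq_zero] at h
    rcases h with h | h
    · exact h
    · exfalso
      have h' : ((i + 1 : ℕ) : F) = 0 := by exact_mod_cast h
      rw [CharP.cast_eq_zero_iff F p] at h'
      exact hi (Nat.le_of_dvd (by omega) h')

theorem degree_derivative_lt_sub_one {f : F[X]} {N : ℕ}
    (hf : f.degree < (N : ℕ)) : (derivative f).degree < (N - 1 : ℕ) := by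
  rw [degree_lt_iff_coeff_zero] at hf ⊢
  intro i hi
  rw [coeff_derivative, hf _ (by omega), zero_mul]

theorem degree_lt_natCast_mono {f : F[X]} {M N : ℕ} (h : f.degree < (M : ℕ)) (hMN : M ≤ N) :
    f.degree < (N : ℕ) :=
  h.trans_le (by exact_mod_cast hMN)

theorem eq_zero_of_pow_dvd_of_degree_lt {f q : F[X]} {m : ℕ}
    (hq : q.degree = 1) (hdvd : q ^ m ∣ f) (hf : f.degree < (m : ℕ)) : f = 0 := by
  apply eq_zero_of_dvd_of_degree_lt hdvd
  rw [degree_pow, hq]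
  simpa using hf

theorem degree_one_sub_X : (1 - X : F[X]).degree = 1 := by
  rw [← neg_sub, degree_neg, ← C_1, degree_X_sub_C]

theorem degree_pow_mul_lt {r h : F[X]} {i N : ℕ} (hr : r.degree = 1)
    (hh : h.degree < (N - i : ℕ)) : (r ^ i * h).degree < (N : ℕ) := by
  rcases eq_or_ne h 0 with rfl | h0
  · simp
  rw [degree_mul, degree_pow, hr, degree_eq_natDegree h0]
  rw [degree_eq_natDegree h0] at hh
  have hlt : h.natDegree < N - i := by exact_mod_cast hh
  have hadd : i + h.natDegree < N := by omega
  simpa using (by exact_mod_cast hadd : ((i + h.natDegree : ℕ) : WithBot ℕ) < (N : ℕ))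

theorem isCoprime_X_pow_one_sub_X_pow (m n : ℕ) :
    IsCoprime (X ^ m : F[X]) ((1 - X) ^ n) :=
  IsCoprime.pow ⟨1, 1, by ring⟩

theorem eq_zero_of_pow_dvd_of_add_eq_zero {e m n : ℕ} {f g : F[X]} (he : e < m + n)
    (hf : X ^ m ∣ f) (hg : (1 - X) ^ n ∣ g) (hfd : f.degree < (e + 1 : ℕ)) (hfg : f + g = 0) :
    f = 0 ∧ g = 0 := by
  have hgf : g = -f := by linear_combination hfg
  have hdvd : X ^ m * (1 - X) ^ n ∣ f :=
    (isCoprime_X_pow_one_sub_X_pow m n).mul_dvd hf (by simpa [hgf] using hg)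
  have hf0 : f = 0 := by
    apply eq_zero_of_dvd_of_degree_lt hdvd
    rw [degree_mul, degree_pow, degree_pow, degree_X, degree_one_sub_X]
    have := degree_lt_natCast_mono hfd (N := m + n) (by omega)
    simpa using this
  exact ⟨hf0, by simp [hgf, hf0]⟩

/-- There is no nonzero relation in degree `e` between `x ^ m`, `y ^ n` and `(x + y) ^ k`,
dehomogenized along `x + y = 1`. -/
theorem eq_zero_of_pow_dvd_of_degree_add_lt (p : ℕ) [CharP F p] (e : ℕ) :
    ∀ (k m n : ℕ) (f g : F[X]), e < p → e < m + n → e < m + k → e < n + k →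
      2 * e + 2 ≤ k + m + n → X ^ m ∣ f → (1 - X) ^ n ∣ g →
      f.degree < (e + 1 : ℕ) → g.degree < (e + 1 : ℕ) → (f + g).degree < (e + 1 - k : ℕ) →
      f = 0 ∧ g = 0 := by
  induction e with
  | zero =>
    intro k m n f g hp hmn hmk hnk hs hf hg hfd hgd hfg
    rcases Nat.eq_zero_or_pos k with rfl | hk
    · exact ⟨eq_zero_of_pow_dvd_of_degree_lt degree_X hf (degree_lt_natCast_mono hfd (by omega)),
        eq_zero_of_pow_dvd_of_degree_lt degree_one_sub_X hg
          (degree_lt_natCast_mono hgd (by omega))⟩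
    · refine eq_zero_of_pow_dvd_of_add_eq_zero hmn hf hg hfd ?_
      rw [show 0 + 1 - k = 0 by omega] at hfg
      simpa using hfg
  | succ e ih =>
    intro k m n f g hp hmn hmk hnk hs hf hg hfd hgd hfg
    by_cases hk : e + 1 < k
    · refine eq_zero_of_pow_dvd_of_add_eq_zero hmn hf hg hfd ?_
      rw [show e + 1 + 1 - k = 0 by omega] at hfg
      simpa using hfg
    have key := ih k (m - 1) (n - 1) (derivative f) (derivative g) (by omega) (by omega)
      (by omega) (by omega) (by omega) (pow_sub_one_dvd_derivative_of_pow_dvd hf)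
      (pow_sub_one_dvd_derivative_of_pow_dvd hg) (degree_derivative_lt_sub_one hfd)
      (degree_derivative_lt_sub_one hgd) (by
        rw [← derivative_add]
        exact degree_lt_natCast_mono (degree_derivative_lt_sub_one hfg) (by omega))
    have eq_zero {q h : F[X]} {i : ℕ} (hq : q.degree = 1) (hi : 0 < i) (hdvd : q ^ i ∣ h)
        (hh : derivative h = 0) (hd : h.degree < (e + 1 + 1 : ℕ)) : h = 0 := by
      have hC := eq_C_of_derivative_eq_zero_of_degree_lt_char p hh
        (degree_lt_natCast_mono hd (by omega))
      refine eq_zero_of_pow_dvd_of_degree_lt hq hdvd ?_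
      rw [hC]
      exact degree_C_le.trans_lt (by exact_mod_cast hi)
    exact ⟨eq_zero degree_X (by omega) hf key.1 hfd,
      eq_zero degree_one_sub_X (by omega) hg key.2 hgd⟩

/-- In the balanced degree `e`, every homogeneous form lies in `(x ^ m, y ^ n, (x + y) ^ k)`,
dehomogenized along `x + y = 1`. -/
theorem exists_eq_mul_add_mul_add (p : ℕ) [CharP F p] {e k m n : ℕ} (hp : e < p)
    (hmn : e < m + n) (hmk : e < m + k) (hnk : e < n + k) (hs : 2 * e + 2 = k + m + n)
    {q : F[X]} (hq : q.degree < (e + 1 : ℕ)) :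
    ∃ a b c : F[X], a.degree < (e + 1 - m : ℕ) ∧ b.degree < (e + 1 - n : ℕ) ∧
      c.degree < (e + 1 - k : ℕ) ∧ q = X ^ m * a + (1 - X) ^ n * b + c := by
  let φ : (degreeLT F (e + 1 - m) × degreeLT F (e + 1 - n)) × degreeLT F (e + 1 - k) →ₗ[F]
      degreeLT F (e + 1) := LinearMap.codRestrict _
    (((LinearMap.mulLeft F (X ^ m)).comp (Submodule.subtype _)).coprod
      ((LinearMap.mulLeft F ((1 - X) ^ n)).comp (Submodule.subtype _)) |>.coprod
        (Submodule.subtype _)) (by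
      rintro ⟨⟨a, b⟩, c⟩
      refine Submodule.add_mem _ (Submodule.add_mem _ ?_ ?_) ?_
      · exact mem_degreeLT.2 (degree_pow_mul_lt degree_X (mem_degreeLT.1 a.2))
      · exact mem_degreeLT.2 (degree_pow_mul_lt degree_one_sub_X (mem_degreeLT.1 b.2))
      · exact mem_degreeLT.2 (degree_lt_natCast_mono (mem_degreeLT.1 c.2) (by omega)))
  have hfin (N : ℕ) : Module.Finite F (degreeLT F N) :=
    Module.Finite.equiv (degreeLTEquiv F N).symm
  have hrank (N : ℕ) : Module.finrank F (degreeLT F N) = N := by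
    rw [(degreeLTEquiv F N).finrank_eq, Module.finrank_fin_fun]
  have hinj : Function.Injective φ := by
    rw [← LinearMap.ker_eq_bot, LinearMap.ker_eq_bot']
    rintro ⟨⟨⟨a, ha⟩, ⟨b, hb⟩⟩, ⟨c, hc⟩⟩ h
    have h' : X ^ m * a + (1 - X) ^ n * b + c = 0 := congrArg Subtype.val h
    rw [mem_degreeLT] at ha hb hc
    have hab : X ^ m * a + (1 - X) ^ n * b = -c := by linear_combination h'
    obtain ⟨h1, h2⟩ := eq_zero_of_pow_dvd_of_degree_add_lt p e k m n _ _ hp hmn hmk hnk hs.le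
      (dvd_mul_right _ a) (dvd_mul_right _ b) (degree_pow_mul_lt degree_X ha) (degree_pow_mul_lt degree_one_sub_X hb)
      (by rw [hab, degree_neg]; exact hc)
    have hX : (1 - X : F[X]) ≠ 0 := fun h0 ↦ by simpa [h0] using degree_one_sub_X (F := F)
    have ha0 : a = 0 := by simpa using h1
    have hb0 : b = 0 := (mul_eq_zero.1 h2).resolve_left (pow_ne_zero _ hX)
    have hc0 : c = 0 := by simpa [ha0, hb0] using h'
    subst ha0 hb0 hc0
    rfl
  have hsurj : Function.Surjective φ := by
    rw [← LinearMap.injective_iff_surjective_of_finrank_eq_finrank]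
    · exact hinj
    · simp only [Module.finrank_prod, hrank]
      omega
  obtain ⟨⟨⟨a, b⟩, c⟩, h⟩ := hsurj ⟨q, mem_degreeLT.2 hq⟩
  exact ⟨a, b, c, mem_degreeLT.1 a.2, mem_degreeLT.1 b.2, mem_degreeLT.1 c.2,
    (congrArg Subtype.val h).symm⟩

end Polynomial

section Colength

open scoped Polynomial

variable {F : Type*} [Field F]

theorem mem_Ikmn {k m n : ℕ} {f : MvPolynomial (Fin 2) F} :
    f ∈ Ikmn F k m n ↔
      ∃ a b c, a * X 0 ^ m + b * X 1 ^ n + c * (X 0 + X 1) ^ k = f := by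
  simp [Ikmn, Ideal.span, Submodule.mem_span_triple]

theorem Ikmn_zero (m n : ℕ) : Ikmn F 0 m n = ⊤ :=
  (Ideal.eq_top_iff_one _).2 (mem_Ikmn.2 ⟨0, 0, 1, by simp⟩)

theorem Ikmn_succ_le (k m n : ℕ) : Ikmn F (k + 1) m n ≤ Ikmn F k m n := by
  intro f hf
  obtain ⟨a, b, c, rfl⟩ := mem_Ikmn.1 hf
  exact mem_Ikmn.2 ⟨a, b, c * (X 0 + X 1), by ring⟩

theorem homogenize_pow_mul_mem {J : Ideal (MvPolynomial (Fin 2) F)} {e i : ℕ} {q a : F[X]}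
    {Q : MvPolynomial (Fin 2) F} (hQ : Q.IsHomogeneous 1) (hq : aeval ![Polynomial.X, 1] Q = q)
    (hdeg : q.natDegree ≤ 1) (ha : a.degree < (e + 1 - i : ℕ))
    (hJ : aeval ![X 0, X 0 + X 1] Q ^ i ∈ J) :
    aeval ![X 0, X 0 + X 1] (Polynomial.homogenize (q ^ i * a) e) ∈ J := by
  rcases eq_or_ne a 0 with rfl | h0
  · simp
  rw [Polynomial.degree_eq_natDegree h0] at ha
  have ha' : a.natDegree < e + 1 - i := by exact_mod_cast ha
  have hpow : (q ^ i).homogenize i = Q ^ i :=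
    Polynomial.homogenize_eq_of_isHomogeneous (by simpa using hQ.pow i) (by rw [map_pow, hq])
  obtain ⟨d, rfl⟩ := Nat.exists_eq_add_of_le (show i ≤ e by omega)
  rw [Polynomial.homogenize_mul _ _ (by simpa using Polynomial.natDegree_pow_le_of_le i hdeg)
    (by omega), hpow, map_mul, map_pow]
  exact J.mul_mem_right _ hJ

/-- `x ^ r * (x + y) ^ k` lies in the ideal in the balanced case. -/
theorem X_pow_mul_mem_Ikmn_of_eq (p : ℕ) [CharP F p] {r k m n : ℕ}
    (hs : m + n = 2 * r + k + 1) (hp : r + k < p) (hm : r ≤ m) (hn : r ≤ n) :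
    X 0 ^ r * (X 0 + X 1) ^ k ∈ Ikmn F (k + 1) m n := by
  obtain ⟨a, b, c, ha, hb, hc, h⟩ := Polynomial.exists_eq_mul_add_mul_add (F := F) p
    (e := r + k) (k := k + 1) (m := m) (n := n) hp (by omega) (by omega) (by omega) (by omega)
    (q := Polynomial.X ^ r) (by
      rw [Polynomial.degree_X_pow]
      exact_mod_cast (by omega : r < r + k + 1))
  have key := congrArg (fun q ↦ aeval ![X 0, X 0 + X 1] (Polynomial.homogenize q (r + k)) :
    F[X] → MvPolynomial (Fin 2) F) h
  simp only [Polynomial.homogenize_X_pow (Nat.le_add_right r k), Nat.add_sub_cancel_left,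
    Polynomial.homogenize_add, map_add, map_mul, map_pow, aeval_X, Matrix.cons_val_zero,
    Matrix.cons_val_one] at key
  rw [key]
  refine Ideal.add_mem _ (Ideal.add_mem _ ?_ ?_) ?_
  · refine homogenize_pow_mul_mem (Q := X 0) (isHomogeneous_X _ _) (by simp) (by simp) ha ?_
    exact mem_Ikmn.2 ⟨1, 0, 0, by simp⟩
  · refine homogenize_pow_mul_mem (Q := X 1 - X 0)
      ((isHomogeneous_X _ _).sub (isHomogeneous_X _ _)) (by simp)
      (Polynomial.natDegree_le_of_degree_le Polynomial.degree_one_sub_X.le) hb ?_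
    exact mem_Ikmn.2 ⟨0, 1, 0, by simp⟩
  · have := homogenize_pow_mul_mem (J := Ikmn F (k + 1) m n) (Q := X 1) (q := 1) (a := c)
      (i := k + 1) (e := r + k)
      (isHomogeneous_X _ _) (by simp) (by simp) hc (mem_Ikmn.2 ⟨0, 0, 1, by simp⟩)
    simpa using this

/-- The number of monomials `x ^ i` surviving in `(x + y) ^ k R / (x + y) ^ (k + 1) R`, where
`R = F[x, y] / (x ^ m, y ^ n)`. -/
def layerLength (m n k : ℕ) : ℕ := min (min m n) ((m + n - k) / 2)

theorem X_pow_layerLength_mul_mem_Ikmn (p : ℕ) [CharP F p] {k m n : ℕ}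
    (hm : 1 ≤ m) (hmp : m + (k + 1) ≤ p) (hnp : n + (k + 1) ≤ p) :
    X 0 ^ layerLength m n k * (X 0 + X 1) ^ k ∈ Ikmn F (k + 1) m n := by
  have hr : layerLength m n k = min (min m n) ((m + n - k) / 2) := rfl
  generalize layerLength m n k = r at hr
  by_cases h1 : m ≤ r
  · obtain ⟨i, rfl⟩ := Nat.exists_eq_add_of_le h1
    exact mem_Ikmn.2 ⟨X 0 ^ i * (X 0 + X 1) ^ k, 0, 0, by ring⟩
  by_cases h2 : n ≤ r
  · obtain rfl : r = n := by omega
    obtain ⟨c, hc⟩ : (X 0 + X 1 : MvPolynomial (Fin 2) F) ∣ X 0 ^ r - (-X 1) ^ r := by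
      simpa using sub_dvd_pow_sub_pow (X 0 : MvPolynomial (Fin 2) F) (-X 1) r
    refine mem_Ikmn.2 ⟨0, (-1) ^ r * (X 0 + X 1) ^ k, c, ?_⟩
    rw [neg_pow] at hc
    linear_combination -(X 0 + X 1) ^ k * hc
  by_cases h3 : m + n ≤ k
  · obtain rfl : r = 0 := by omega
    rw [pow_zero, one_mul]
    exact Ideal.add_pow_mem_of_pow_mem_of_le _ (m := m) (n := n)
      (mem_Ikmn.2 ⟨1, 0, 0, by simp⟩) (mem_Ikmn.2 ⟨0, 1, 0, by simp⟩) (by omega)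
  by_cases hpar : m + n = 2 * r + k + 1
  · exact X_pow_mul_mem_Ikmn_of_eq p hpar (by omega) (by omega) (by omega)
  · obtain ⟨r, rfl⟩ := Nat.exists_eq_succ_of_ne_zero (show r ≠ 0 by omega)
    obtain ⟨m, rfl⟩ := Nat.exists_eq_succ_of_ne_zero (show m ≠ 0 by omega)
    obtain ⟨a, b, c, h⟩ := mem_Ikmn.1 (X_pow_mul_mem_Ikmn_of_eq (F := F) p (r := r) (k := k)
      (m := m) (n := n) (by omega) (by omega) (by omega) (by omega))
    exact mem_Ikmn.2 ⟨a, b * X 0, c * X 0, by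
      simp only [Nat.succ_eq_add_one, pow_succ (X 0 : MvPolynomial (Fin 2) F)]
      linear_combination X 0 * h⟩

/-- The substitution `x ↦ T * W`, `y ↦ (1 - T) * W`; the power of `W` records the degree. -/
noncomputable def gradedDehomogenize (F : Type*) [Field F] :
    MvPolynomial (Fin 2) F →ₐ[F] F[X][X] :=
  aeval ![Polynomial.C Polynomial.X * Polynomial.X,
    Polynomial.C (1 - Polynomial.X) * Polynomial.X]

theorem degree_coeff_gradedDehomogenize_lt (f : MvPolynomial (Fin 2) F) (i : ℕ) :
    ((gradedDehomogenize F f).coeff i).degree < (i + 1 : ℕ) := by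
  rw [← Polynomial.mem_degreeLT]
  induction f using MvPolynomial.induction_on generalizing i with
  | C a =>
    rw [← algebraMap_eq, AlgHom.commutes, Polynomial.algebraMap_apply, Polynomial.coeff_C]
    split_ifs
    · rw [Polynomial.mem_degreeLT, Polynomial.algebraMap_apply]
      exact Polynomial.degree_C_le.trans_lt (by exact_mod_cast Nat.succ_pos i)
    · exact Submodule.zero_mem _
  | add f g hf hg =>
    rw [map_add, Polynomial.coeff_add]
    exact Submodule.add_mem _ (hf i) (hg i)
  | mul_X f j hf =>
    have hlin (q : F[X]) (hq : q.degree = 1) :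
        (gradedDehomogenize F f * (Polynomial.C q * Polynomial.X)).coeff i ∈
          Polynomial.degreeLT F (i + 1) := by
      rw [← mul_assoc]
      rcases i with _ | i
      · simp
      rw [Polynomial.coeff_mul_X, Polynomial.coeff_mul_C]
      have := hf i
      rw [Polynomial.mem_degreeLT] at this ⊢
      rw [mul_comm, ← pow_one q]
      exact Polynomial.degree_pow_mul_lt hq this
    rw [map_mul]
    fin_cases j
    · simpa [gradedDehomogenize] using hlin _ Polynomial.degree_X
    · simpa [gradedDehomogenize] using hlin _ Polynomial.degree_one_sub_X

theorem coeff_gradedDehomogenize_aeval (q : F[X]) (i : ℕ) :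
    (gradedDehomogenize F (Polynomial.aeval (X 0) q)).coeff i =
      Polynomial.C (q.coeff i) * Polynomial.X ^ i := by
  rw [← Polynomial.aeval_algHom_apply]
  induction q using Polynomial.induction_on' with
  | add f g hf hg => simp [hf, hg, add_mul]
  | monomial j a =>
    simp only [gradedDehomogenize, aeval_X, Matrix.cons_val_zero, Polynomial.aeval_monomial,
      mul_pow, ← Polynomial.C_pow, Polynomial.algebraMap_apply, Polynomial.coeff_C_mul,
      Polynomial.coeff_X_pow, Polynomial.coeff_monomial]
    rcases eq_or_ne j i with rfl | h
    · simp
    · simp [h, h.symm]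

theorem eq_zero_of_aeval_mul_mem_Ikmn (p : ℕ) [CharP F p] {k m n : ℕ}
    (hmp : m + (k + 1) ≤ p) (hnp : n + (k + 1) ≤ p) {q : F[X]}
    (hq : q.degree < (layerLength m n k : ℕ))
    (h : Polynomial.aeval (X 0) q * (X 0 + X 1) ^ k ∈ Ikmn F (k + 1) m n) : q = 0 := by
  have hr : layerLength m n k = min (min m n) ((m + n - k) / 2) := rfl
  rw [hr, Polynomial.degree_lt_iff_coeff_zero] at hq
  ext i
  rw [Polynomial.coeff_zero]
  by_cases hi : min (min m n) ((m + n - k) / 2) ≤ i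
  · exact hq i hi
  obtain ⟨a, b, c, habc⟩ := mem_Ikmn.1 h
  have hx : gradedDehomogenize F (X 0) = Polynomial.C Polynomial.X * Polynomial.X := by
    simp [gradedDehomogenize]
  have hy : gradedDehomogenize F (X 1) = Polynomial.C (1 - Polynomial.X) * Polynomial.X := by
    simp [gradedDehomogenize]
  have hz : gradedDehomogenize F (X 0 + X 1) = Polynomial.X := by
    rw [map_add, hx, hy, ← add_mul, ← map_add]; simp
  have key := congrArg (fun f ↦ (gradedDehomogenize F f).coeff (i + k)) habc
  simp only [map_add, map_mul, map_pow, Polynomial.coeff_add] at key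
  rw [← map_add, hz, hx, hy, Polynomial.coeff_mul_X_pow, coeff_gradedDehomogenize_aeval] at key
  set f := (gradedDehomogenize F a * (Polynomial.C Polynomial.X * Polynomial.X) ^ m).coeff (i + k)
    with hf
  set g := (gradedDehomogenize F b *
    (Polynomial.C (1 - Polynomial.X) * Polynomial.X) ^ n).coeff (i + k) with hg
  set u := (gradedDehomogenize F c * Polynomial.X ^ (k + 1)).coeff (i + k) with hu
  have hdeg (f : MvPolynomial (Fin 2) F) :
      ((gradedDehomogenize F f).coeff (i + k)).degree < (i + k + 1 : ℕ) :=
    degree_coeff_gradedDehomogenize_lt f _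
  have hdvd (f : F[X][X]) (q : F[X]) (j : ℕ) :
      q ^ j ∣ (f * (Polynomial.C q * Polynomial.X) ^ j).coeff (i + k) := by
    rw [mul_pow, ← Polynomial.C_pow, mul_left_comm, Polynomial.coeff_C_mul]
    exact dvd_mul_right _ _
  have hud : u.degree < (i : ℕ) := by
    rw [hu, Polynomial.coeff_mul_X_pow']
    split_ifs with hle
    · exact Polynomial.degree_lt_natCast_mono (degree_coeff_gradedDehomogenize_lt c _) (by omega)
    · simp
  obtain ⟨hf0, hg0⟩ := Polynomial.eq_zero_of_pow_dvd_of_degree_add_lt (F := F) p (i + k) k m n f g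
    (by omega) (by omega) (by omega) (by omega) (by omega) (hdvd _ _ _) (hdvd _ _ _)
    (by rw [hf, ← hx, ← map_pow, ← map_mul]; exact hdeg _)
    (by rw [hg, ← hy, ← map_pow, ← map_mul]; exact hdeg _) (by
      rw [show f + g = Polynomial.C (q.coeff i) * Polynomial.X ^ i - u by
        linear_combination key, ← Polynomial.mem_degreeLT]
      refine Submodule.sub_mem _ ?_ ?_
      · rw [Polynomial.mem_degreeLT]
        exact (Polynomial.degree_C_mul_X_pow_le _ _).trans_lt
          (by exact_mod_cast (by omega : i < i + k + 1 - k))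
      · exact Polynomial.mem_degreeLT.2 (Polynomial.degree_lt_natCast_mono hud (by omega)))
  rw [hf0, hg0, zero_add, zero_add] at key
  rw [key, Polynomial.degree_lt_iff_coeff_zero] at hud
  simpa using hud i le_rfl

theorem exists_eq_aeval_add_mul (f : MvPolynomial (Fin 2) F) :
    ∃ (q : F[X]) (g : MvPolynomial (Fin 2) F), f = Polynomial.aeval (X 0) q + g * (X 0 + X 1) := by
  induction f using MvPolynomial.induction_on with
  | C a => exact ⟨Polynomial.C a, 0, by simp [algebraMap_eq]⟩
  | add f g hf hg =>
    obtain ⟨q, u, rfl⟩ := hf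
    obtain ⟨r, v, rfl⟩ := hg
    exact ⟨q + r, u + v, by rw [map_add]; ring⟩
  | mul_X f j hf =>
    obtain ⟨q, u, rfl⟩ := hf
    fin_cases j
    · exact ⟨q * Polynomial.X, u * X 0, by
        simp only [map_mul, Polynomial.aeval_X, Fin.zero_eta]; ring⟩
    · exact ⟨-(q * Polynomial.X), u * X 1 + Polynomial.aeval (X 0) q, by
        simp only [map_neg, map_mul, Polynomial.aeval_X, Fin.mk_one]; ring⟩

/-- The map `q(T) ↦ q(x) * (x + y) ^ k` onto the layer `(x + y) ^ k R / (x + y) ^ (k + 1) R`, where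
`R = F[x, y] / (x ^ m, y ^ n)`. -/
noncomputable def layerMap (F : Type*) [Field F] (k m n : ℕ) :
    Polynomial.degreeLT F (layerLength m n k) →ₗ[F]
      MvPolynomial (Fin 2) F ⧸ Ikmn F (k + 1) m n :=
  (Ideal.Quotient.mkₐ F (Ikmn F (k + 1) m n)).toLinearMap ∘ₗ
    LinearMap.mulRight F ((X 0 + X 1) ^ k) ∘ₗ
      (Polynomial.aeval (X 0)).toLinearMap ∘ₗ Submodule.subtype _

theorem layerMap_apply {k m n : ℕ} (q : Polynomial.degreeLT F (layerLength m n k)) :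
    layerMap F k m n q = Ideal.Quotient.mk (Ikmn F (k + 1) m n)
      (Polynomial.aeval (X 0) (q : F[X]) * (X 0 + X 1) ^ k) := rfl

theorem layerMap_injective (p : ℕ) [CharP F p] {k m n : ℕ}
    (hmp : m + (k + 1) ≤ p) (hnp : n + (k + 1) ≤ p) :
    Function.Injective (layerMap F k m n) := by
  rw [← LinearMap.ker_eq_bot, LinearMap.ker_eq_bot']
  rintro ⟨q, hq⟩ h
  rw [layerMap_apply, Ideal.Quotient.eq_zero_iff_mem] at h
  exact Subtype.ext (eq_zero_of_aeval_mul_mem_Ikmn p hmp hnp (Polynomial.mem_degreeLT.1 hq) h)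

theorem range_layerMap (p : ℕ) [CharP F p] {k m n : ℕ}
    (hm : 1 ≤ m) (hmp : m + (k + 1) ≤ p) (hnp : n + (k + 1) ≤ p) :
    LinearMap.range (layerMap F k m n) =
      LinearMap.ker (Ideal.Quotient.factorₐ F (Ikmn_succ_le (F := F) k m n)).toLinearMap := by
  apply le_antisymm
  · rintro _ ⟨q, rfl⟩
    rw [LinearMap.mem_ker, layerMap_apply]
    refine Ideal.Quotient.eq_zero_iff_mem.2 (mem_Ikmn.2 ⟨0, 0, Polynomial.aeval (X 0) (q : F[X]), by ring⟩)
  · intro v hv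
    obtain ⟨f, rfl⟩ := Ideal.Quotient.mk_surjective v
    obtain ⟨a, b, c, rfl⟩ := mem_Ikmn.1 (Ideal.Quotient.eq_zero_iff_mem.1 hv)
    obtain ⟨q, g, rfl⟩ := exists_eq_aeval_add_mul c
    have hmonic : (Polynomial.X ^ layerLength m n k : F[X]).Monic := Polynomial.monic_X_pow _
    refine ⟨⟨q %ₘ Polynomial.X ^ layerLength m n k, ?_⟩, ?_⟩
    · rw [Polynomial.mem_degreeLT]
      simpa using Polynomial.degree_modByMonic_lt q hmonic
    · rw [layerMap_apply, Ideal.Quotient.eq]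
      have hq := congrArg (Polynomial.aeval (X 0 : MvPolynomial (Fin 2) F))
        (Polynomial.modByMonic_add_div q (Polynomial.X ^ layerLength m n k))
      obtain ⟨a', b', c', h⟩ := mem_Ikmn.1 (X_pow_layerLength_mul_mem_Ikmn (F := F) p hm hmp hnp)
      simp only [map_add, map_mul, map_pow, Polynomial.aeval_X] at hq
      set s := Polynomial.aeval (X 0 : MvPolynomial (Fin 2) F)
        (q /ₘ Polynomial.X ^ layerLength m n k)
      refine mem_Ikmn.2 ⟨-s * a' - a, -s * b' - b, -s * c' - g, ?_⟩
      linear_combination -s * h - (X 0 + X 1) ^ k * hq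

theorem finite_and_finrank_quotient_Ikmn (p : ℕ) [CharP F p] {k m n : ℕ}
    (hm : 1 ≤ m) (hmp : m + k ≤ p) (hnp : n + k ≤ p) :
    FiniteDimensional F (MvPolynomial (Fin 2) F ⧸ Ikmn F k m n) ∧
      Module.finrank F (MvPolynomial (Fin 2) F ⧸ Ikmn F k m n) =
        ∑ j ∈ Finset.range k, layerLength m n j := by
  induction k with
  | zero =>
    have : Subsingleton (MvPolynomial (Fin 2) F ⧸ Ikmn F 0 m n) :=
      Ideal.Quotient.subsingleton_iff.2 (Ikmn_zero m n)
    exact ⟨inferInstance, by simp [Module.finrank_zero_of_subsingleton]⟩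
  | succ k ih =>
    obtain ⟨hfin, hrank⟩ := ih (by omega) (by omega)
    set β := (Ideal.Quotient.factorₐ F (Ikmn_succ_le (F := F) k m n)).toLinearMap with hβ
    have hsurj : Function.Surjective β := Ideal.Quotient.factor_surjective (Ikmn_succ_le k m n)
    have hinj := layerMap_injective (F := F) p hmp hnp
    have hexact := range_layerMap (F := F) p hm hmp hnp
    have hdom : Module.Finite F (Polynomial.degreeLT F (layerLength m n k)) :=
      Module.Finite.equiv (Polynomial.degreeLTEquiv F _).symm
    have hker : Module.Finite F (LinearMap.ker β) := by
      rw [hβ, ← hexact]; infer_instance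
    have hquot : Module.Finite F ((MvPolynomial (Fin 2) F ⧸ Ikmn F (k + 1) m n) ⧸
        LinearMap.ker β) :=
      Module.Finite.equiv (β.quotKerEquivOfSurjective hsurj).symm
    have hfin' : Module.Finite F (MvPolynomial (Fin 2) F ⧸ Ikmn F (k + 1) m n) :=
      Module.Finite.of_submodule_quotient (LinearMap.ker β)
    refine ⟨hfin', ?_⟩
    rw [← LinearMap.finrank_range_add_finrank_ker β, LinearMap.range_eq_top.2 hsurj, finrank_top,
      hrank, Finset.sum_range_succ, hβ, ← hexact, LinearMap.finrank_range_of_inj hinj,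
      (Polynomial.degreeLTEquiv F _).finrank_eq, Module.finrank_fin_fun]

end Colength

section LayerLength

theorem layerLength_comm (m n k : ℕ) : layerLength m n k = layerLength n m k := by
  rw [layerLength, layerLength, min_comm m, add_comm m]

theorem sum_layerLength_of_add_le {k m n : ℕ} (h : k + n ≤ m + 1) :
    ∑ j ∈ Finset.range k, layerLength m n j = k * n := by
  rw [Finset.sum_congr rfl (g := fun _ ↦ n), Finset.sum_const, Finset.card_range, smul_eq_mul]
  intro j hj
  rw [Finset.mem_range] at hj
  rw [layerLength]
  omega

theorem sum_layerLength_add_two_mul {d n a : ℕ} (ha : a ≤ n) :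
    (∑ j ∈ Finset.range (d + 2 * a), layerLength (d + n) n j : ℤ) =
      d * n + 2 * a * n - a ^ 2 := by
  induction a with
  | zero =>
    have := sum_layerLength_of_add_le (k := d) (m := d + n) (n := n) (by omega)
    simpa using mod_cast this
  | succ a ih =>
    have h1 : layerLength (d + n) n (d + 2 * a) = n - a := by rw [layerLength]; omega
    have h2 : layerLength (d + n) n (d + 2 * a + 1) = n - a - 1 := by rw [layerLength]; omega
    rw [show d + 2 * (a + 1) = d + 2 * a + 1 + 1 by ring, Finset.sum_range_succ,
      Finset.sum_range_succ, ih (by omega), h1, h2]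
    push_cast [show 1 ≤ n - a by omega, show a ≤ n by omega]
    ring

theorem sum_layerLength_add_two_mul_add_one {d n a : ℕ} (ha : a ≤ n) :
    (∑ j ∈ Finset.range (d + 2 * a + 1), layerLength (d + n) n j : ℤ) =
      d * n + 2 * a * n - a ^ 2 + n - a := by
  have h1 : layerLength (d + n) n (d + 2 * a) = n - a := by rw [layerLength]; omega
  rw [Finset.sum_range_succ, sum_layerLength_add_two_mul ha, h1]
  push_cast [ha]
  ring

theorem sum_layerLength_of_le {k m n : ℕ} (h : m + n ≤ k + 1) :
    ∑ j ∈ Finset.range k, layerLength m n j = m * n := by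
  wlog hnm : n ≤ m generalizing m n
  · simp_rw [layerLength_comm m n, mul_comm m n]
    exact this (by omega) (by omega)
  obtain ⟨i, rfl⟩ := Nat.exists_eq_add_of_le (show m + n - 1 ≤ k by omega)
  induction i with
  | zero =>
    rcases n with _ | n
    · simp [layerLength]
    obtain ⟨d, rfl⟩ := Nat.exists_eq_add_of_le' hnm
    have := sum_layerLength_add_two_mul_add_one (d := d) (n := n + 1) (a := n) (by omega)
    rw [show d + (n + 1) + (n + 1) - 1 + 0 = d + 2 * n + 1 by omega]
    zify
    rw [this]
    push_cast
    ring
  | succ i ih =>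
    rw [← add_assoc, Finset.sum_range_succ, ih (by omega), layerLength]
    omega

theorem sum_layerLength_eq_choose {k m n : ℕ} (hk : k + 2 ≤ m + n) (hm : m + 2 ≤ k + n)
    (hn : n + 2 ≤ k + m) :
    (∑ j ∈ Finset.range k, layerLength m n j : ℤ) =
      (Nat.choose ((k + m + n - 3) / 2 + 2) 2 : ℤ)
        - ((Nat.choose ((k + m + n - 3) / 2 + 2 - k) 2 : ℤ)
          + (Nat.choose ((k + m + n - 3) / 2 + 2 - m) 2 : ℤ)
          + (Nat.choose ((k + m + n - 3) / 2 + 2 - n) 2 : ℤ)) := by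
  wlog hnm : n ≤ m generalizing m n
  · simp_rw [layerLength_comm m n]
    rw [this (by omega) (by omega) (by omega) (by omega), show k + n + m = k + m + n by ring]
    ring
  have hchoose (x : ℕ) : (2 : ℤ) * (x.choose 2 : ℤ) = x * (x - 1) := by
    have h := Nat.cast_choose_two ℚ x
    have h' : (2 : ℚ) * (x.choose 2 : ℚ) = x * (x - 1) := by rw [h]; ring
    exact_mod_cast h'
  obtain ⟨d, rfl⟩ := Nat.exists_eq_add_of_le' hnm
  obtain ⟨i, rfl⟩ := Nat.exists_eq_add_of_le (show d ≤ k by omega)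
  apply mul_left_cancel₀ (two_ne_zero (α := ℤ))
  rw [mul_sub, mul_add, mul_add, hchoose, hchoose, hchoose, hchoose]
  obtain ⟨a, rfl | rfl⟩ := Nat.even_or_odd' i
  · rw [sum_layerLength_add_two_mul (by omega),
      show (d + 2 * a + (d + n) + n - 3) / 2 + 2 = d + a + n by omega,
      show d + a + n - (d + 2 * a) = n - a by omega,
      show d + a + n - (d + n) = a by omega, show d + a + n - n = d + a by omega]
    push_cast [show a ≤ n by omega]
    ring
  · rw [← add_assoc, sum_layerLength_add_two_mul_add_one (by omega),
      show (d + 2 * a + 1 + (d + n) + n - 3) / 2 + 2 = d + a + n + 1 by omega,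
      show d + a + n + 1 - (d + 2 * a + 1) = n - a by omega,
      show d + a + n + 1 - (d + n) = a + 1 by omega,
      show d + a + n + 1 - n = d + a + 1 by omega]
    push_cast [show a ≤ n by omega]
    ring

end LayerLength

/-- The length `ℓ_{k,m,n}` in characteristic `p` with `m, n ≤ p - k`, computed via the
weak Lefschetz property.  Here `d₀ ≥ d₁ ≥ d₂` is the non-increasing rearrangement of
`k, m, n` and `t = k + m + n - 3`. -/
theorem stmt13 (p : ℕ) (hp : p.Prime) (F : Type*) [Field F] [CharP F p] (k m n : ℕ)
    (hk : 1 ≤ k) (hm : 1 ≤ m) (hn : 1 ≤ n) (hmp : m + k ≤ p) (hnp : n + k ≤ p)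
    (d₀ d₁ d₂ : ℕ) (hperm : ({d₀, d₁, d₂} : Multiset ℕ) = ({k, m, n} : Multiset ℕ))
    (h01 : d₁ ≤ d₀) (h12 : d₂ ≤ d₁) :
    FiniteDimensional F (MvPolynomial (Fin 2) F ⧸ Ikmn F k m n) ∧
    (2 * d₀ ≤ (k + m + n - 3) + 1 →
      (Module.finrank F (MvPolynomial (Fin 2) F ⧸ Ikmn F k m n) : ℤ)
        = (Nat.choose ((k + m + n - 3) / 2 + 2) 2 : ℤ)
          - ((Nat.choose ((k + m + n - 3) / 2 + 2 - k) 2 : ℤ)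
            + (Nat.choose ((k + m + n - 3) / 2 + 2 - m) 2 : ℤ)
            + (Nat.choose ((k + m + n - 3) / 2 + 2 - n) 2 : ℤ))) ∧
    ((k + m + n - 3) + 1 < 2 * d₀ →
      Module.finrank F (MvPolynomial (Fin 2) F ⧸ Ikmn F k m n) = d₁ * d₂) := by
  obtain ⟨hfin, hrank⟩ := finite_and_finrank_quotient_Ikmn (F := F) p hm hmp hnp
  have hcases : (d₀ = k ∧ (d₁ = m ∧ d₂ = n ∨ d₁ = n ∧ d₂ = m)) ∨
      (d₀ = m ∧ (d₁ = k ∧ d₂ = n ∨ d₁ = n ∧ d₂ = k)) ∨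
      (d₀ = n ∧ (d₁ = k ∧ d₂ = m ∨ d₁ = m ∧ d₂ = k)) := by
    simp only [Multiset.insert_eq_cons, Multiset.cons_eq_cons] at hperm
    simp at hperm
    grind [Multiset.singleton_inj]
  rw [hrank]
  refine ⟨hfin, fun h ↦ ?_, fun h ↦ ?_⟩
  · push_cast
    exact sum_layerLength_eq_choose (by omega) (by omega) (by omega)
  · rcases hcases with ⟨rfl, h'⟩ | ⟨rfl, h'⟩ | ⟨rfl, h'⟩
    · rw [sum_layerLength_of_le (by omega)]
      rcases h' with ⟨rfl, rfl⟩ | ⟨rfl, rfl⟩ <;> ring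
    · rw [sum_layerLength_of_add_le (by omega)]
      rcases h' with ⟨rfl, rfl⟩ | ⟨rfl, rfl⟩ <;> ring
    · simp_rw [layerLength_comm m]
      rw [sum_layerLength_of_add_le (by omega)]
      rcases h' with ⟨rfl, rfl⟩ | ⟨rfl, rfl⟩ <;> ring
end
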